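/- arXiv:2401.06434 — 2 statements merged into one kernel-verified Lean document; each statement's English description precedes it below -/
import Mathlib

section
/- Weighted fractional Orlicz–Hardy inequality: let N ≥ 1, s ∈ (0,1), α₁, α₂ ∈ ℝ, γ = s − α₁ − α₂, and let Φ be an Orlicz function with p⁺ = sup_{t>0} tφ(t)/Φ(t). If γ < N/p⁺, then there exists C > 0 such that ∫_{ℝ^N} Φ(|u(x)|/|x|^γ) dx ≤ C ∫_{ℝ^N}∫_{ℝ^N} Φ(|x|^{α₁}|y|^{α₂}|u(x)−u(y)|/|x−y|^s) dx dy/|x−y|^N for all u ∈ C_c¹(ℝ^N). -/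
open Set Filter MeasureTheory

/-- An Orlicz function `Φ` together with its right derivative `φ`:
`Φ` is continuous, convex on `[0,∞)`, vanishes at `0`, satisfies
`Φ(t)/t → 0` as `t → 0⁺`, `Φ(t)/t → ∞` as `t → ∞`, the Δ₂-condition,
and has the representation `Φ(t) = ∫₀ᵗ φ(s) ds` with `φ` non-decreasing,
right-continuous, `φ(0) = 0`, `φ(t) > 0` for `t > 0`, `φ(t) → ∞`. -/
structure IsOrliczPair (Φ φ : ℝ → ℝ) : Prop where
  continuousOn : ContinuousOn Φ (Ici 0)
  convexOn : ConvexOn ℝ (Ici 0) Φ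
  map_zero : Φ 0 = 0
  tendsto_zero : Tendsto (fun t => Φ t / t) (nhdsWithin 0 (Ioi 0)) (nhds 0)
  tendsto_atTop : Tendsto (fun t => Φ t / t) atTop atTop
  delta2 : ∃ C > 0, ∀ t ≥ 0, Φ (2 * t) ≤ C * Φ t
  rep : ∀ t ≥ 0, Φ t = ∫ s in (0:ℝ)..t, φ s
  deriv_mono : MonotoneOn φ (Ici 0)
  deriv_rightCont : ∀ t ≥ 0, ContinuousWithinAt φ (Ici t) t
  deriv_zero : φ 0 = 0
  deriv_pos : ∀ t > 0, 0 < φ t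
  deriv_atTop : Tendsto φ atTop atTop

/-- The set of values `t·φ(t)/Φ(t)` for `t > 0`, whose infimum and supremum
are `p⁻_Φ` and `p⁺_Φ`. -/
def orliczRatioSet (Φ φ : ℝ → ℝ) : Set ℝ := {r : ℝ | ∃ t > 0, r = t * φ t / Φ t}

namespace IsOrliczPair

variable {Φ φ : ℝ → ℝ}

lemma intervalIntegrable (h : IsOrliczPair Φ φ) {a b : ℝ} (ha : 0 ≤ a) (hb : 0 ≤ b) :
    IntervalIntegrable φ volume a b := by
  apply MonotoneOn.intervalIntegrable
  apply h.deriv_mono.mono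
  intro x hx
  exact (le_min ha hb).trans hx.1

lemma pos (h : IsOrliczPair Φ φ) {t : ℝ} (ht : 0 < t) : 0 < Φ t := by
  rw [h.rep t ht.le]
  exact intervalIntegral.intervalIntegral_pos_of_pos_on (h.intervalIntegrable le_rfl ht.le)
    (fun x hx => h.deriv_pos x hx.1) ht

lemma nonneg (h : IsOrliczPair Φ φ) {t : ℝ} (ht : 0 ≤ t) : 0 ≤ Φ t := by
  rcases ht.eq_or_lt with rfl | ht
  · exact h.map_zero.ge
  · exact (h.pos ht).le

lemma mono (h : IsOrliczPair Φ φ) {a b : ℝ} (ha : 0 ≤ a) (hab : a ≤ b) : Φ a ≤ Φ b := by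
  have hb := ha.trans hab
  have h1 := intervalIntegral.integral_interval_sub_left
    (h.intervalIntegrable le_rfl hb) (h.intervalIntegrable le_rfl ha)
  have h2 : 0 ≤ ∫ x in a..b, φ x := by
    apply intervalIntegral.integral_nonneg hab
    intro x hx
    have hx0 : 0 ≤ x := ha.trans hx.1
    simpa [h.deriv_zero] using h.deriv_mono (mem_Ici.2 le_rfl) (mem_Ici.2 hx0) hx0
  rw [h.rep a ha, h.rep b hb]
  linarith

lemma hasDerivWithinAt (h : IsOrliczPair Φ φ) {t : ℝ} (ht : 0 ≤ t) :
    HasDerivWithinAt Φ (φ t) (Ici t) t := by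
  have hmeas : StronglyMeasurableAtFilter φ (nhdsWithin t (Ioi t)) volume := by
    refine ⟨Ioi t, self_mem_nhdsWithin, ?_⟩
    have : AEMeasurable φ (volume.restrict (Ioi t)) :=
      aemeasurable_restrict_of_monotoneOn measurableSet_Ioi
        (h.deriv_mono.mono fun x hx => ht.trans (le_of_lt hx))
    exact this.aestronglyMeasurable
  have := intervalIntegral.integral_hasDerivWithinAt_right (s := Ici t) (t := Ioi t)
    (h.intervalIntegrable le_rfl ht) hmeas ((h.deriv_rightCont t ht).mono Ioi_subset_Ici_self)
  exact this.congr (fun x hx => h.rep x (ht.trans hx)) (h.rep t ht)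

lemma exponent_pos (h : IsOrliczPair Φ φ) {p : ℝ} (hp : p ∈ upperBounds (orliczRatioSet Φ φ)) :
    0 < p := by
  have h1 := hp ⟨1, one_pos, rfl⟩
  exact lt_of_lt_of_le
    (div_pos (mul_pos one_pos (h.deriv_pos 1 one_pos)) (h.pos one_pos)) h1

lemma map_mul_le (h : IsOrliczPair Φ φ) {p : ℝ} (hp : p ∈ upperBounds (orliczRatioSet Φ φ))
    {c t : ℝ} (hc : 1 ≤ c) (ht : 0 ≤ t) : Φ (c * t) ≤ c ^ p * Φ t := by
  rcases ht.eq_or_lt with rfl | ht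
  · simp [h.map_zero]
  have hle : t ≤ c * t := le_mul_of_one_le_left ht.le hc
  have key : Φ (c * t) * (c * t) ^ (-p) ≤ Φ t * t ^ (-p) := by
    refine image_le_of_deriv_right_le_deriv_boundary (f := fun x => Φ x * x ^ (-p))
      (f' := fun x => φ x * x ^ (-p) + Φ x * (-p * x ^ (-p - 1)))
      (B := fun _ => Φ t * t ^ (-p)) (B' := fun _ => 0) (a := t) (b := c * t)
      ?_ ?_ le_rfl continuousOn_const ?_ ?_ (right_mem_Icc.2 hle)
    · apply (h.continuousOn.mono fun x hx => ht.le.trans hx.1).mul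
      exact ContinuousOn.rpow_const continuousOn_id fun x hx => Or.inl (ht.trans_le hx.1).ne'
    · intro x hx
      have hx0 : 0 < x := ht.trans_le hx.1
      exact (h.hasDerivWithinAt hx0.le).mul
        (Real.hasDerivAt_rpow_const (Or.inl hx0.ne')).hasDerivWithinAt
    · exact fun x _ => hasDerivWithinAt_const _ _ _
    · intro x hx
      have hx0 : 0 < x := ht.trans_le hx.1
      have h1 : x * φ x / Φ x ≤ p := hp ⟨x, hx0, rfl⟩
      rw [div_le_iff₀ (h.pos hx0)] at h1
      have h2 : x ^ (-p) = x ^ (-p - 1) * x := by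
        rw [← Real.rpow_add_one hx0.ne']; ring_nf
      have h3 : 0 < x ^ (-p - 1) := Real.rpow_pos_of_pos hx0 _
      rw [h2]
      nlinarith
  have hc0 : 0 < c := by linarith
  rw [Real.rpow_neg (by positivity), Real.rpow_neg ht.le, Real.mul_rpow hc0.le ht.le,
    ← div_eq_mul_inv, ← div_eq_mul_inv, div_le_div_iff₀ (by positivity) (by positivity)] at key
  have : 0 < t ^ p := by positivity
  nlinarith

lemma map_add_le (h : IsOrliczPair Φ φ) {p : ℝ} (hp : p ∈ upperBounds (orliczRatioSet Φ φ))
    {a b : ℝ} (ha : 0 ≤ a) (hb : 0 ≤ b) : Φ (a + b) ≤ 2 ^ p * (Φ a + Φ b) := by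
  have h2 : (0:ℝ) < 2 ^ p := by positivity
  have hm : Φ (max a b) ≤ Φ a + Φ b := by
    rcases max_choice a b with e | e <;> rw [e]
    · linarith [h.nonneg hb]
    · linarith [h.nonneg ha]
  calc Φ (a + b) ≤ Φ (2 * max a b) :=
        h.mono (by positivity) (by linarith [le_max_left a b, le_max_right a b])
    _ ≤ 2 ^ p * Φ (max a b) := h.map_mul_le hp one_le_two (le_max_of_le_left ha)
    _ ≤ _ := by gcongr

lemma continuous_comp_max (h : IsOrliczPair Φ φ) : Continuous fun t => Φ (max t 0) :=
  h.continuousOn.comp_continuous (by fun_prop) fun _ => mem_Ici.2 (le_max_right _ _)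

end IsOrliczPair

lemma lintegral_le_of_forall_ball_compl {E : Type*} [NormedAddCommGroup E] [MeasurableSpace E]
    [BorelSpace E] {μ : Measure E} [NullSingletonClass μ] {F : E → ENNReal} {B : ENNReal}
    (hB : ∀ ρ > 0, ∫⁻ x in {x | ρ < ‖x‖}, F x ∂μ ≤ B) : ∫⁻ x, F x ∂μ ≤ B := by
  have hU : (⋃ n : ℕ, {x : E | 1 / ((n : ℝ) + 1) < ‖x‖}) = {0}ᶜ := by
    ext x
    simp only [mem_iUnion, mem_ofPred_eq, mem_compl_iff, mem_singleton_iff]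
    constructor
    · rintro ⟨n, hn⟩ rfl
      rw [norm_zero] at hn
      exact absurd hn (not_lt.2 (by positivity))
    · exact fun hx => exists_nat_one_div_lt (norm_pos_iff.2 hx)
  have hd : Directed (· ⊆ ·) fun n : ℕ => {x : E | 1 / ((n : ℝ) + 1) < ‖x‖} := by
    apply Monotone.directed_le
    intro m n hmn x hx
    exact lt_of_le_of_lt (Nat.one_div_le_one_div hmn) (mem_ofPred_eq ▸ hx)
  have h0 : ∫⁻ x, F x ∂μ = ∫⁻ x in {0}ᶜ, F x ∂μ := by
    rw [Measure.restrict_eq_self_of_ae_mem (s := ({0}ᶜ : Set E))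
      (compl_mem_ae_iff.2 (measure_singleton 0))]
  rw [h0, ← hU, setLIntegral_iUnion_of_directed _ hd]
  exact iSup_le fun n => hB _ (by positivity)

/-- If `F` at `x` is controlled by `F` on the annulus `R‖x‖ ≤ ‖y‖ ≤ 2R‖x‖`, up to a kernel `G`,
with a coefficient that is small compared to `R ^ N`, then `F` is controlled by `G` alone. -/
lemma lintegral_le_of_annulus_le {E : Type*} [NormedAddCommGroup E] [NormedSpace ℝ E]
    [FiniteDimensional ℝ E] [Nontrivial E] [MeasurableSpace E] [BorelSpace E] {μ : Measure E}
    [μ.IsAddHaarMeasure] {N : ℕ} (hN : Module.finrank ℝ E = N)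
    {F : E → ENNReal} (hF : Measurable F)
    (hfin : ∀ ρ > 0, ∫⁻ x in {x | ρ < ‖x‖}, F x ∂μ ≠ ⊤)
    {G : E → E → ENNReal}
    {R a b : ℝ} (hR : 1 ≤ R) (ha : 0 ≤ a) (haR : a * 2 ^ N * 2 ≤ R ^ N)
    (hFG : ∀ x y, x ≠ 0 → R * ‖x‖ ≤ ‖y‖ → ‖y‖ ≤ 2 * R * ‖x‖ →
      ENNReal.ofReal ((‖x‖ ^ N)⁻¹) * F x ≤
        ENNReal.ofReal a * (ENNReal.ofReal ((‖x‖ ^ N)⁻¹) * F y) + ENNReal.ofReal b * G x y) :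
    ∫⁻ x, F x ∂μ ≤ ENNReal.ofReal
        (2 * b / (R ^ N * (μ (Metric.ball (0 : E) 1)).toReal)) *
      ∫⁻ x, ∫⁻ y, G x y ∂μ ∂μ := by
  have hN0 : N ≠ 0 := hN ▸ Module.finrank_pos.ne'
  have hR0 : 0 < R := by linarith
  set v := (μ (Metric.ball (0 : E) 1)).toReal
  have hvE : μ (Metric.ball (0 : E) 1) = ENNReal.ofReal v :=
    (ENNReal.ofReal_toReal measure_ball_lt_top.ne).symm
  have hv0 : 0 < v := ENNReal.toReal_pos (Metric.measure_ball_pos _ _ one_pos).ne'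
    measure_ball_lt_top.ne
  have hclosed (r : ℝ) (hr : 0 ≤ r) :
      μ (Metric.closedBall (0 : E) r) = ENNReal.ofReal (r ^ N * v) := by
    rw [Measure.addHaar_closedBall _ _ hr, hvE, ← ENNReal.ofReal_mul (by positivity)]
    rw [hN]
  have hopen (r : ℝ) (hr : 0 ≤ r) :
      μ (Metric.ball (0 : E) r) = ENNReal.ofReal (r ^ N * v) := by
    rw [Measure.addHaar_ball _ _ hr, hvE, ← ENNReal.ofReal_mul (by positivity)]
    rw [hN]
  apply lintegral_le_of_forall_ball_compl
  intro ρ hρ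
  set J := ∫⁻ x, ∫⁻ y, G x y ∂μ ∂μ
  set I := ∫⁻ x in {x : E | ρ < ‖x‖}, F x ∂μ with hI
  set T : Set (E × E) :=
    {z | ρ < ‖z.1‖} ∩ ({z | R * ‖z.1‖ ≤ ‖z.2‖} ∩ {z | ‖z.2‖ ≤ 2 * R * ‖z.1‖})
  have hTm : MeasurableSet T := by
    apply MeasurableSet.inter (measurableSet_lt (by fun_prop) (by fun_prop))
    exact (measurableSet_le (by fun_prop) (by fun_prop)).inter
      (measurableSet_le (by fun_prop) (by fun_prop))
  set w : E → ENNReal := fun x => ENNReal.ofReal ((‖x‖ ^ N)⁻¹) with hw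
  have hwm : Measurable w := by fun_prop
  set H : E → E → ENNReal := fun x y => T.indicator (fun z => w z.1 * F z.2) (x, y) with hH
  have hHm : Measurable (Function.uncurry H) := by
    have : Measurable fun z : E × E => w z.1 * F z.2 := by fun_prop
    exact this.indicator hTm
  have hpoint (x : E) (hx : ρ < ‖x‖) : ENNReal.ofReal (R ^ N * v) * F x ≤
      ENNReal.ofReal a * (∫⁻ y, H x y ∂μ) + ENNReal.ofReal b * ∫⁻ y, G x y ∂μ := by
    have hx0 : 0 < ‖x‖ := hρ.trans hx
    set A : Set E := {y | R * ‖x‖ ≤ ‖y‖} ∩ {y | ‖y‖ ≤ 2 * R * ‖x‖} with hA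
    have hAm : MeasurableSet A :=
      (measurableSet_le (by fun_prop) (by fun_prop)).inter
        (measurableSet_le (by fun_prop) (by fun_prop))
    have hAvol : ENNReal.ofReal ((R * ‖x‖) ^ N * v) ≤ μ A := by
      have hAe : A = Metric.closedBall (0 : E) (2 * R * ‖x‖) \ Metric.ball 0 (R * ‖x‖) := by
        ext y
        simp [hA, and_comm]
      refine le_trans ?_ (hAe ▸ le_measure_sdiff)
      rw [hclosed _ (by positivity), hopen _ (by positivity),
        ← ENNReal.ofReal_sub _ (by positivity)]
      apply ENNReal.ofReal_le_ofReal
      have h2 : (2:ℝ) ≤ 2 ^ N := le_self_pow₀ one_le_two hN0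
      have h3 : (2 * R * ‖x‖) ^ N = 2 ^ N * (R * ‖x‖) ^ N := by rw [mul_assoc, mul_pow]
      have h4 : 0 < (R * ‖x‖) ^ N * v := by positivity
      rw [h3]
      nlinarith
    calc ENNReal.ofReal (R ^ N * v) * F x
        = ENNReal.ofReal ((R * ‖x‖) ^ N * v) * (w x * F x) := by
          rw [← mul_assoc, hw, ← ENNReal.ofReal_mul (by positivity)]
          congr 2
          rw [mul_pow]
          field_simp
      _ ≤ μ A * (w x * F x) := by gcongr
      _ = ∫⁻ y in A, w x * F x ∂μ := by rw [setLIntegral_const, mul_comm]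
      _ ≤ ∫⁻ y in A, (ENNReal.ofReal a * (w x * F y) + ENNReal.ofReal b * G x y) ∂μ :=
          setLIntegral_mono' hAm fun y hy => hFG x y (norm_pos_iff.1 hx0) hy.1 hy.2
      _ = ENNReal.ofReal a * (∫⁻ y in A, w x * F y ∂μ) + ENNReal.ofReal b * ∫⁻ y in A, G x y ∂μ := by
          rw [lintegral_add_left (by fun_prop),
            lintegral_const_mul' (ENNReal.ofReal a) _ ENNReal.ofReal_ne_top,
            lintegral_const_mul' (ENNReal.ofReal b) _ ENNReal.ofReal_ne_top]
      _ ≤ _ := by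
          refine add_le_add (mul_le_mul_right ?_ _)
            (mul_le_mul_right (setLIntegral_le_lintegral _ _) _)
          · rw [← lintegral_indicator hAm]
            apply lintegral_mono
            intro y
            by_cases hy : y ∈ A
            · have : (x, y) ∈ T := ⟨hx, hy.1, hy.2⟩
              simp [hH, hy, this]
            · simp [hy]
  have hswap : ∫⁻ x, ∫⁻ y, H x y ∂μ ∂μ ≤ ENNReal.ofReal (2 ^ N * v) * I := by
    rw [lintegral_lintegral_swap hHm.aemeasurable, hI, ← lintegral_const_mul' _ _
      ENNReal.ofReal_ne_top, ← lintegral_indicator (measurableSet_lt (by fun_prop) (by fun_prop))]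
    apply lintegral_mono
    intro y
    by_cases hy : ρ < ‖y‖
    · have hy0 : 0 < ‖y‖ := hρ.trans hy
      rw [indicator_of_mem (by exact hy)]
      have hle (x : E) : H x y ≤ (Metric.closedBall (0 : E) (‖y‖ / R)).indicator
          (fun _ => ENNReal.ofReal ((2 * R / ‖y‖) ^ N) * F y) x := by
        by_cases hz : (x, y) ∈ T
        · obtain ⟨h1, h2, h3⟩ : ρ < ‖x‖ ∧ R * ‖x‖ ≤ ‖y‖ ∧ ‖y‖ ≤ 2 * R * ‖x‖ := hz
          have hx0 : 0 < ‖x‖ := hρ.trans h1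
          have hxm : x ∈ Metric.closedBall (0 : E) (‖y‖ / R) := by
            rw [mem_closedBall_zero_iff, le_div_iff₀ hR0]
            linarith
          simp only [hH]
          rw [indicator_of_mem hxm, indicator_of_mem (by exact ⟨h1, h2, h3⟩)]
          simp only [hw]
          gcongr
          rw [← inv_pow]
          gcongr
          rw [inv_le_comm₀ hx0 (by positivity), inv_div, div_le_iff₀ (by positivity)]
          linarith
        · simp [hH, hz]
      calc ∫⁻ x, H x y ∂μ ≤ _ := lintegral_mono hle
        _ = ENNReal.ofReal ((2 * R / ‖y‖) ^ N) * F y *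
            ENNReal.ofReal ((‖y‖ / R) ^ N * v) := by
          rw [lintegral_indicator Metric.isClosed_closedBall.measurableSet, setLIntegral_const,
            hclosed _ (by positivity)]
        _ = ENNReal.ofReal (2 ^ N * v) * F y := by
          rw [mul_right_comm, ← ENNReal.ofReal_mul (by positivity)]
          congr 2
          rw [← mul_assoc, ← mul_pow]
          congr 2
          field_simp
    · have hz (x : E) : H x y = 0 := by
        simp only [hH]
        apply indicator_of_notMem
        intro hz
        obtain ⟨h1, h2, -⟩ : ρ < ‖x‖ ∧ R * ‖x‖ ≤ ‖y‖ ∧ ‖y‖ ≤ 2 * R * ‖x‖ := hz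
        nlinarith
      simp [hz]
  have hmain : ENNReal.ofReal (R ^ N * v) * I ≤
      ENNReal.ofReal (R ^ N * v / 2) * I + ENNReal.ofReal b * J := by
    calc ENNReal.ofReal (R ^ N * v) * I
        = ∫⁻ x in {x : E | ρ < ‖x‖}, ENNReal.ofReal (R ^ N * v) * F x ∂μ :=
          (lintegral_const_mul' _ _ ENNReal.ofReal_ne_top).symm
      _ ≤ ∫⁻ x in {x : E | ρ < ‖x‖},
            (ENNReal.ofReal a * (∫⁻ y, H x y ∂μ) + ENNReal.ofReal b * ∫⁻ y, G x y ∂μ) ∂μ :=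
          setLIntegral_mono' (measurableSet_lt (by fun_prop) (by fun_prop)) hpoint
      _ ≤ ∫⁻ x, (ENNReal.ofReal a * (∫⁻ y, H x y ∂μ) + ENNReal.ofReal b * ∫⁻ y, G x y ∂μ) ∂μ :=
          lintegral_mono' Measure.restrict_le_self le_rfl
      _ = ENNReal.ofReal a * (∫⁻ x, ∫⁻ y, H x y ∂μ ∂μ) + ENNReal.ofReal b * J := by
          rw [lintegral_add_left (f := fun x => ENNReal.ofReal a * ∫⁻ y, H x y ∂μ)
              (hHm.lintegral_prod_right'.const_mul _),
            lintegral_const_mul' _ _ ENNReal.ofReal_ne_top,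
            lintegral_const_mul' _ _ ENNReal.ofReal_ne_top]
      _ ≤ ENNReal.ofReal a * (ENNReal.ofReal (2 ^ N * v) * I) + ENNReal.ofReal b * J := by gcongr
      _ ≤ _ := by
          rw [← mul_assoc, ← ENNReal.ofReal_mul ha]
          gcongr
          nlinarith
  have hItop : I ≠ ⊤ := hfin ρ hρ
  have habsorb : ENNReal.ofReal (R ^ N * v / 2) * I ≤ ENNReal.ofReal b * J := by
    have hsplit : ENNReal.ofReal (R ^ N * v) * I =
        ENNReal.ofReal (R ^ N * v / 2) * I + ENNReal.ofReal (R ^ N * v / 2) * I := by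
      rw [← add_mul, ← ENNReal.ofReal_add (by positivity) (by positivity), add_halves]
    rw [hsplit] at hmain
    exact (ENNReal.add_le_add_iff_left (ENNReal.mul_ne_top ENNReal.ofReal_ne_top hItop)).1 hmain
  calc I = ENNReal.ofReal (2 / (R ^ N * v)) * (ENNReal.ofReal (R ^ N * v / 2) * I) := by
        rw [← mul_assoc, ← ENNReal.ofReal_mul (by positivity)]
        have : 2 / (R ^ N * v) * (R ^ N * v / 2) = 1 := by field_simp
        rw [this, ENNReal.ofReal_one, one_mul]
    _ ≤ ENNReal.ofReal (2 / (R ^ N * v)) * (ENNReal.ofReal b * J) := by gcongr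
    _ = _ := by
        rw [← mul_assoc, ← ENNReal.ofReal_mul (by positivity)]
        congr 2
        ring

/-- Pointwise comparison of the Hardy integrand with the Gagliardo integrand for `y` in the annulus
`R‖x‖ ≤ ‖y‖ ≤ 2R‖x‖`. -/
lemma IsOrliczPair.annulus_estimate {E : Type*} [NormedAddCommGroup E] {Φ φ : ℝ → ℝ}
    (h : IsOrliczPair Φ φ) {p : ℝ} (hp : p ∈ upperBounds (orliczRatioSet Φ φ))
    {s α₁ α₂ R : ℝ} (hs : 0 ≤ s) (hR : 2 ≤ R) (u : E → ℝ) {x y : E} (hx : x ≠ 0)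
    (h1 : R * ‖x‖ ≤ ‖y‖) (h2 : ‖y‖ ≤ 2 * R * ‖x‖) (N : ℕ) :
    (‖x‖ ^ N)⁻¹ * Φ (|u x| / ‖x‖ ^ (s - α₁ - α₂)) ≤
      2 ^ p * ((2 * R) ^ max (s - α₁ - α₂) 0) ^ p *
          ((‖x‖ ^ N)⁻¹ * Φ (|u y| / ‖y‖ ^ (s - α₁ - α₂))) +
        2 ^ p * ((2 * R) ^ |α₂| * (3 * R) ^ s) ^ p * (3 * R) ^ N *
          (Φ (‖x‖ ^ α₁ * ‖y‖ ^ α₂ * (|u x - u y| / ‖x - y‖ ^ s)) / ‖x - y‖ ^ (N : ℝ)) := by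
  set γ := s - α₁ - α₂ with hγ
  have hr : 0 < ‖x‖ := norm_pos_iff.2 hx
  have hR0 : 0 < R := by linarith
  have hq : 0 < ‖y‖ := lt_of_lt_of_le (by positivity) h1
  have hd : 0 < ‖x - y‖ := by
    have := norm_sub_norm_le y x
    rw [norm_sub_rev] at this
    nlinarith
  have hd' : ‖x - y‖ ≤ 3 * R * ‖x‖ := by
    have := norm_sub_le x y
    nlinarith
  set r := ‖x‖
  set q := ‖y‖
  set d := ‖x - y‖
  set D := |u x - u y|
  set t := q / r with ht
  have ht1 : 1 ≤ t := by rw [ht, one_le_div hr]; nlinarith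
  have ht2 : t ≤ 2 * R := by rwa [ht, div_le_iff₀ hr]
  have hqt : q = t * r := by rw [ht]; field_simp
  have hpow (β δ : ℝ) (hβ : β ≤ δ) (hδ : 0 ≤ δ) : t ^ β ≤ (2 * R) ^ δ :=
    (Real.rpow_le_rpow_of_exponent_le ht1 hβ).trans
      (Real.rpow_le_rpow (by linarith) ht2 hδ)
  have hsplit : Φ (|u x| / r ^ γ) ≤ 2 ^ p * (Φ (|u y| / r ^ γ) + Φ (D / r ^ γ)) := by
    refine le_trans (h.mono (by positivity) ?_) (h.map_add_le hp (by positivity) (by positivity))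
    rw [← add_div]
    gcongr
    have := abs_add_le (u y) (u x - u y)
    simpa using this
  have hy : Φ (|u y| / r ^ γ) ≤ ((2 * R) ^ max γ 0) ^ p * Φ (|u y| / q ^ γ) := by
    refine le_trans (h.mono (by positivity) ?_)
      (h.map_mul_le hp (Real.one_le_rpow (by linarith) (le_max_right _ _)) (by positivity))
    have hb := hpow γ (max γ 0) (le_max_left _ _) (le_max_right _ _)
    have ht0 : 0 < t := by linarith
    rw [hqt, Real.mul_rpow ht0.le hr.le]
    calc |u y| / r ^ γ = t ^ γ * (|u y| / (t ^ γ * r ^ γ)) := by field_simp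
      _ ≤ _ := by gcongr
  have hD : Φ (D / r ^ γ) ≤ ((2 * R) ^ |α₂| * (3 * R) ^ s) ^ p *
      Φ (r ^ α₁ * q ^ α₂ * (D / d ^ s)) := by
    have hM : 1 ≤ (2 * R) ^ |α₂| * (3 * R) ^ s :=
      one_le_mul_of_one_le_of_one_le (Real.one_le_rpow (by linarith) (abs_nonneg _))
        (Real.one_le_rpow (by linarith) hs)
    refine le_trans (h.mono (by positivity) ?_) (h.map_mul_le hp hM (by positivity))
    have hb := hpow (-α₂) |α₂| (neg_le_abs _) (abs_nonneg _)
    have ht0 : 0 < t := by linarith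
    have hds : d ^ s ≤ (3 * R) ^ s * r ^ s := by
      rw [← Real.mul_rpow (by positivity) hr.le]
      exact Real.rpow_le_rpow hd.le hd' hs
    have hrγ : r ^ γ = r ^ s / (r ^ α₁ * r ^ α₂) := by
      rw [hγ, Real.rpow_sub hr, Real.rpow_sub hr]; field_simp
    have htt : t ^ (-α₂) * t ^ α₂ = 1 := by
      rw [← Real.rpow_add ht0]; simp
    rw [hqt, Real.mul_rpow ht0.le hr.le, hrγ]
    calc D / (r ^ s / (r ^ α₁ * r ^ α₂))
        = (t ^ (-α₂) * t ^ α₂) * (r ^ α₁ * r ^ α₂) * D * (d ^ s / (r ^ s * d ^ s)) := by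
          rw [htt]; field_simp
      _ ≤ ((2 * R) ^ |α₂| * t ^ α₂) * (r ^ α₁ * r ^ α₂) * D *
          ((3 * R) ^ s * r ^ s / (r ^ s * d ^ s)) := by gcongr
      _ = _ := by field_simp
  have hw : (r ^ N)⁻¹ ≤ (3 * R) ^ N / d ^ (N : ℝ) := by
    rw [Real.rpow_natCast, inv_le_comm₀ (by positivity) (by positivity), inv_div,
      div_le_iff₀ (by positivity), ← mul_pow]
    gcongr
    linarith
  have hΦ : 0 ≤ Φ (r ^ α₁ * q ^ α₂ * (D / d ^ s)) := h.nonneg (by positivity)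
  calc (r ^ N)⁻¹ * Φ (|u x| / r ^ γ)
      ≤ (r ^ N)⁻¹ * (2 ^ p * (((2 * R) ^ max γ 0) ^ p * Φ (|u y| / q ^ γ) +
          ((2 * R) ^ |α₂| * (3 * R) ^ s) ^ p * Φ (r ^ α₁ * q ^ α₂ * (D / d ^ s)))) := by
        refine mul_le_mul_of_nonneg_left (hsplit.trans ?_) (by positivity)
        gcongr
    _ = 2 ^ p * ((2 * R) ^ max γ 0) ^ p * ((r ^ N)⁻¹ * Φ (|u y| / q ^ γ)) +
        2 ^ p * ((2 * R) ^ |α₂| * (3 * R) ^ s) ^ p *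
          ((r ^ N)⁻¹ * Φ (r ^ α₁ * q ^ α₂ * (D / d ^ s))) := by ring
    _ ≤ 2 ^ p * ((2 * R) ^ max γ 0) ^ p * ((r ^ N)⁻¹ * Φ (|u y| / q ^ γ)) +
        2 ^ p * ((2 * R) ^ |α₂| * (3 * R) ^ s) ^ p *
          ((3 * R) ^ N / d ^ (N : ℝ) * Φ (r ^ α₁ * q ^ α₂ * (D / d ^ s))) := by
        gcongr
    _ = _ := by ring

lemma IsOrliczPair.measurable_comp_weight {E : Type*} [NormedAddCommGroup E] [MeasurableSpace E]
    [BorelSpace E] {Φ φ : ℝ → ℝ} (h : IsOrliczPair Φ φ) {u : E → ℝ} (hu : Continuous u) (γ : ℝ) :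
    Measurable fun x => Φ (|u x| / ‖x‖ ^ γ) := by
  have h1 : Measurable fun x => |u x| / ‖x‖ ^ γ :=
    hu.abs.measurable.div (measurable_norm.pow_const γ)
  have h2 := h.continuous_comp_max.measurable.comp h1
  convert h2 using 2 with x
  rw [Function.comp_apply, max_eq_left (by positivity)]

lemma IsOrliczPair.setLIntegral_comp_weight_ne_top {E : Type*} [NormedAddCommGroup E]
    [MeasurableSpace E] [BorelSpace E] {μ : Measure E} [IsFiniteMeasureOnCompacts μ]
    {Φ φ : ℝ → ℝ} (h : IsOrliczPair Φ φ) {u : E → ℝ} (hu : Continuous u)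
    (hc : HasCompactSupport u) (γ : ℝ) {ρ : ℝ} (hρ : 0 < ρ) :
    ∫⁻ x in {x | ρ < ‖x‖}, ENNReal.ofReal (Φ (|u x| / ‖x‖ ^ γ)) ∂μ ≠ ⊤ := by
  set K : Set E := tsupport u ∩ {x | ρ ≤ ‖x‖}
  have hKc : IsCompact K := hc.isCompact.inter_right (isClosed_le continuous_const continuous_norm)
  have hcont : ContinuousOn (fun x => Φ (|u x| / ‖x‖ ^ γ)) K := by
    refine h.continuousOn.comp (hu.abs.continuousOn.div ?_ ?_) fun x _ => ?_
    · exact continuous_norm.continuousOn.rpow_const fun x hx => Or.inl (hρ.trans_le hx.2).ne'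
    · exact fun x hx => (Real.rpow_pos_of_pos (hρ.trans_le hx.2) _).ne'
    · exact mem_Ici.2 (by positivity)
  have hle : ∫⁻ x in {x | ρ < ‖x‖}, ENNReal.ofReal (Φ (|u x| / ‖x‖ ^ γ)) ∂μ ≤
      ∫⁻ x in K, ENNReal.ofReal (Φ (|u x| / ‖x‖ ^ γ)) ∂μ := by
    rw [← lintegral_indicator (measurableSet_lt (by fun_prop) (by fun_prop)),
      ← lintegral_indicator hKc.measurableSet]
    apply lintegral_mono
    intro x
    by_cases hx : x ∈ tsupport u
    · by_cases hxρ : ρ < ‖x‖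
      · have hxK : x ∈ K := ⟨hx, hxρ.le⟩
        simp [hxρ, hxK]
      · simp [hxρ]
    · have : u x = 0 := image_eq_zero_of_notMem_tsupport hx
      simp [indicator, this, h.map_zero]
  obtain ⟨C, hC⟩ := hKc.exists_bound_of_continuousOn hcont
  refine ne_top_of_le_ne_top ?_ (hle.trans (setLIntegral_mono' hKc.measurableSet
    (g := fun _ => ENNReal.ofReal C) fun x hx =>
      ENNReal.ofReal_le_ofReal ((le_abs_self _).trans (hC x hx))))
  rw [setLIntegral_const]
  exact ENNReal.mul_ne_top ENNReal.ofReal_ne_top hKc.measure_lt_top.ne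

lemma exists_two_le_mul_rpow_le_pow {N : ℕ} {c β : ℝ} (hβ : β < N) :
    ∃ R : ℝ, 2 ≤ R ∧ c * R ^ β ≤ R ^ N := by
  have h := (tendsto_rpow_atTop (sub_pos.2 hβ)).eventually_ge_atTop c
  obtain ⟨R, hR, hR2⟩ := (h.and (eventually_ge_atTop 2)).exists
  refine ⟨R, hR2, ?_⟩
  have hR0 : 0 < R := by linarith
  rw [Real.rpow_sub hR0, Real.rpow_natCast, le_div_iff₀ (by positivity)] at hR
  exact hR

/-- Weighted fractional Orlicz–Hardy inequality on `ℝ^N` for `γ < N/p⁺_Φ`. -/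
theorem weighted_fractional_orlicz_hardy
    (N : ℕ) (hN : 1 ≤ N) (s α₁ α₂ : ℝ) (hs : s ∈ Ioo (0:ℝ) 1)
    (Φ φ : ℝ → ℝ) (h : IsOrliczPair Φ φ)
    (pp : ℝ) (hpp : IsLUB (orliczRatioSet Φ φ) pp)
    (γ : ℝ) (hγ : γ = s - α₁ - α₂) (hcrit : γ < (N : ℝ) / pp) :
    ∃ C > 0, ∀ u : EuclideanSpace ℝ (Fin N) → ℝ,
      ContDiff ℝ 1 u → HasCompactSupport u →
      (∫⁻ x, ENNReal.ofReal (Φ (|u x| / ‖x‖ ^ γ))) ≤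
        ENNReal.ofReal C *
          ∫⁻ x, ∫⁻ y, ENNReal.ofReal
            (Φ (‖x‖ ^ α₁ * ‖y‖ ^ α₂ * (|u x - u y| / ‖x - y‖ ^ s)) /
              ‖x - y‖ ^ (N:ℝ)) := by
  have hp := hpp.1
  have : Nonempty (Fin N) := ⟨⟨0, hN⟩⟩
  have hp0 : 0 < pp := h.exponent_pos hp
  have hβ : max γ 0 * pp < N := by
    rw [max_mul_of_nonneg _ _ hp0.le, zero_mul, max_lt_iff]
    exact ⟨(lt_div_iff₀ hp0).1 hcrit, by exact_mod_cast hN⟩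
  obtain ⟨R, hR2, hR⟩ := exists_two_le_mul_rpow_le_pow
    (c := 2 ^ pp * (2 ^ max γ 0) ^ pp * 2 ^ N * 2) hβ
  have hR0 : 0 < R := by linarith
  set b : ℝ := 2 ^ pp * ((2 * R) ^ |α₂| * (3 * R) ^ s) ^ pp * (3 * R) ^ N with hb
  have hb0 : 0 < b := by positivity
  have hv0 : 0 < (volume (Metric.ball (0 : EuclideanSpace ℝ (Fin N)) 1)).toReal :=
    ENNReal.toReal_pos (Metric.measure_ball_pos _ _ one_pos).ne' measure_ball_lt_top.ne
  refine ⟨_, div_pos (mul_pos two_pos hb0) (mul_pos (pow_pos hR0 N) hv0), fun u hu hc => ?_⟩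
  refine lintegral_le_of_annulus_le finrank_euclideanSpace_fin
    (h.measurable_comp_weight hu.continuous γ).ennreal_ofReal
    (fun ρ hρ => h.setLIntegral_comp_weight_ne_top hu.continuous hc γ hρ)
    (R := R) (a := 2 ^ pp * ((2 * R) ^ max γ 0) ^ pp) (by linarith) (by positivity)
    ?_ fun x y hx h1 h2 => ?_
  · refine le_trans (le_of_eq ?_) hR
    rw [Real.mul_rpow zero_le_two hR0.le, Real.mul_rpow (by positivity) (by positivity),
      ← Real.rpow_mul hR0.le]
    ring
  · have key := h.annulus_estimate hp (α₁ := α₁) (α₂ := α₂) hs.1.le hR2 u hx h1 h2 N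
    rw [← hγ, ← hb] at key
    have hy : 0 ≤ Φ (|u y| / ‖y‖ ^ γ) := h.nonneg (by positivity)
    have hD : 0 ≤ Φ (‖x‖ ^ α₁ * ‖y‖ ^ α₂ * (|u x - u y| / ‖x - y‖ ^ s)) :=
      h.nonneg (by positivity)
    rw [← ENNReal.ofReal_mul (by positivity), ← ENNReal.ofReal_mul (by positivity),
      ← ENNReal.ofReal_mul (by positivity), ← ENNReal.ofReal_mul (by positivity),
      ← ENNReal.ofReal_add (by positivity) (by positivity)]
    exact ENNReal.ofReal_le_ofReal key
end

section
/- For the Orlicz function S(t) = t^p + t^q with 1 < p < q < ∞, let γ = N/q and s ∈ (0,1) with s = γ (i.e. the unweighted case α₁ = α₂ = 0 and N = sq). Then the fractional Orlicz–Hardy inequality ∫_{ℝ^N} S(|u(x)|/|x|^γ) dx ≤ C ∫_{ℝ^N}∫_{ℝ^N} S(|u(x)−u(y)|/|x−y|^s) dx dy/|x−y|^N fails on C_c¹(ℝ^N \ {0}): there exists a sequence u_n ∈ C_c¹(ℝ^N \ {0}) with 0 ≤ u_n ≤ 1 such that the double integrals on the right remain bounded while ∫_{ℝ^N} S(u_n(x)/|x|^γ)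 dx ≥ log(n/2) → ∞. -/
open Set Filter MeasureTheory ENNReal

open Module

section GagliardoEnergy

variable {E : Type*} [NormedAddCommGroup E] [NormedSpace ℝ E] [FiniteDimensional ℝ E]
  [MeasurableSpace E] [BorelSpace E]

/-- The `r`-th power of the Gagliardo seminorm of `v` of order `s` and exponent `r`. -/
noncomputable def gagliardoEnergy (μ : Measure E) (s r : ℝ) (v : E → ℝ) : ℝ≥0∞ :=
  ∫⁻ x, ∫⁻ y, ENNReal.ofReal
    (|v x - v y| ^ r / ‖x - y‖ ^ ((finrank ℝ E : ℝ) + s * r)) ∂μ ∂μ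

lemma measurable_gagliardo_integrand {v : E → ℝ} (hv : Measurable v) (r a : ℝ) :
    Measurable fun z : E × E ↦
      ENNReal.ofReal (|v z.1 - v z.2| ^ r / ‖z.1 - z.2‖ ^ a) := by
  have h : Measurable fun z : E × E ↦ |v z.1 - v z.2| :=
    ((hv.comp measurable_fst).sub (hv.comp measurable_snd)).norm
  have h' : Measurable fun z : E × E ↦ ‖z.1 - z.2‖ :=
    (measurable_fst.sub measurable_snd).norm
  exact ((h.pow_const r).div (h'.pow_const a)).ennreal_ofReal

lemma abs_sub_rpow_le {r : ℝ} (hr : 0 ≤ r) (a b : ℝ) :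
    |a - b| ^ r ≤ 2 ^ r * (|a| ^ r + |b| ^ r) := by
  have hmax : |a - b| ≤ 2 * max |a| |b| := by
    have := abs_sub a b
    linarith [le_max_left |a| |b|, le_max_right |a| |b|]
  calc |a - b| ^ r ≤ (2 * max |a| |b|) ^ r :=
        Real.rpow_le_rpow (abs_nonneg _) hmax hr
    _ = 2 ^ r * (max |a| |b|) ^ r := Real.mul_rpow (by norm_num) (by positivity)
    _ ≤ 2 ^ r * (|a| ^ r + |b| ^ r) := by
        gcongr
        rcases max_choice |a| |b| with h | h <;> rw [h]
        · exact le_add_of_nonneg_right (by positivity)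
        · exact le_add_of_nonneg_left (by positivity)

lemma gagliardoEnergy_sub_le (μ : Measure E) [SFinite μ] (s : ℝ) {r : ℝ} (hr : 0 ≤ r)
    {v : E → ℝ} (hv : Measurable v) (w : E → ℝ) :
    gagliardoEnergy μ s r (fun x ↦ v x - w x) ≤
      ENNReal.ofReal (2 ^ r) * (gagliardoEnergy μ s r v + gagliardoEnergy μ s r w) := by
  unfold gagliardoEnergy
  set a : ℝ := (finrank ℝ E : ℝ) + s * r
  have hmv := measurable_gagliardo_integrand hv r a
  rw [← lintegral_add_left hmv.lintegral_prod_right',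
    ← lintegral_const_mul' _ _ ENNReal.ofReal_ne_top]
  refine lintegral_mono fun x ↦ ?_
  have hx := hmv.comp (measurable_prodMk_left (x := x))
  simp only [Function.comp_def] at hx
  dsimp only
  rw [← lintegral_add_left hx, ← lintegral_const_mul' _ _ ENNReal.ofReal_ne_top]
  refine lintegral_mono fun y ↦ ?_
  dsimp only
  rw [← ENNReal.ofReal_add (by positivity) (by positivity),
    ← ENNReal.ofReal_mul (by positivity)]
  apply ENNReal.ofReal_le_ofReal
  rw [← add_div, ← mul_div_assoc]
  gcongr
  calc |v x - w x - (v y - w y)| ^ r = |(v x - v y) - (w x - w y)| ^ r := by ring_nf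
    _ ≤ _ := abs_sub_rpow_le hr _ _

lemma lintegral_comp_smul_addHaar (μ : Measure E) [μ.IsAddHaarMeasure] {c : ℝ} (hc : 0 < c)
    (f : E → ℝ≥0∞) :
    ∫⁻ x, f (c • x) ∂μ = ENNReal.ofReal ((c ^ finrank ℝ E)⁻¹) * ∫⁻ x, f x ∂μ := by
  have h := lintegral_map_equiv (μ := μ) f (MeasurableEquiv.smul₀ c hc.ne' : E ≃ᵐ E)
  rw [MeasurableEquiv.coe_smul₀, Measure.map_addHaar_smul μ hc.ne', lintegral_smul_measure,
    abs_of_pos (by positivity)] at h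
  exact h.symm

lemma gagliardoEnergy_comp_smul_le (μ : Measure E) [μ.IsAddHaarMeasure] {s r c : ℝ}
    (hc : 1 ≤ c) (hsr : s * r ≤ finrank ℝ E) (v : E → ℝ) :
    gagliardoEnergy μ s r (fun x ↦ v (c • x)) ≤ gagliardoEnergy μ s r v := by
  have hc0 : 0 < c := by linarith
  set d : ℕ := finrank ℝ E
  set a : ℝ := (d : ℝ) + s * r with ha
  set F : E → E → ℝ≥0∞ := fun x y ↦ ENNReal.ofReal (|v x - v y| ^ r / ‖x - y‖ ^ a) with hF
  have hpt (x y : E) : ENNReal.ofReal (|v (c • x) - v (c • y)| ^ r / ‖x - y‖ ^ a) =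
      ENNReal.ofReal (c ^ a) * F (c • x) (c • y) := by
    rw [hF, ← ENNReal.ofReal_mul (by positivity), ← smul_sub, norm_smul, Real.norm_eq_abs,
      abs_of_pos hc0, Real.mul_rpow hc0.le (norm_nonneg _)]
    have := (Real.rpow_pos_of_pos hc0 a).ne'
    congr 1
    rw [← mul_div_assoc, mul_div_mul_left _ _ this]
  have hK : ENNReal.ofReal (c ^ a) * (ENNReal.ofReal ((c ^ d)⁻¹) *
      ENNReal.ofReal ((c ^ d)⁻¹)) ≤ 1 := by
    rw [← ENNReal.ofReal_mul (by positivity), ← ENNReal.ofReal_mul (by positivity),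
      ENNReal.ofReal_le_one, ← mul_inv, ← div_eq_mul_inv, div_le_one (by positivity),
      ← pow_add, ← Real.rpow_natCast]
    apply Real.rpow_le_rpow_of_exponent_le hc
    push_cast
    linarith
  calc gagliardoEnergy μ s r (fun x ↦ v (c • x))
      = ∫⁻ x, ∫⁻ y, ENNReal.ofReal (c ^ a) * F (c • x) (c • y) ∂μ ∂μ := by
        unfold gagliardoEnergy
        simp_rw [← hpt]
        rfl
    _ = ENNReal.ofReal (c ^ a) * (ENNReal.ofReal ((c ^ d)⁻¹) *
          ENNReal.ofReal ((c ^ d)⁻¹)) * gagliardoEnergy μ s r v := by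
        simp_rw [lintegral_const_mul' _ _ ENNReal.ofReal_ne_top]
        simp_rw [fun x ↦ lintegral_comp_smul_addHaar μ hc0 (F (c • x))]
        rw [lintegral_const_mul' _ _ ENNReal.ofReal_ne_top,
          lintegral_comp_smul_addHaar μ hc0 (fun x ↦ ∫⁻ y, F x y ∂μ)]
        simp only [mul_assoc]
        rfl
    _ ≤ gagliardoEnergy μ s r v := mul_le_of_le_one_left' hK

lemma integrable_gagliardo_kernel [Nontrivial E] (μ : Measure E) [μ.IsAddHaarMeasure]
    {s r : ℝ} (hs0 : 0 < s) (hs1 : s < 1) (hr : 0 < r) :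
    Integrable (fun h : E ↦ (min 1 ‖h‖) ^ r / ‖h‖ ^ ((finrank ℝ E : ℝ) + s * r)) μ := by
  have hd : 1 ≤ finrank ℝ E := finrank_pos
  refine (integrable_fun_norm_addHaar μ
    (f := fun t ↦ (min 1 t) ^ r / t ^ ((finrank ℝ E : ℝ) + s * r))).2 ?_
  have hsr := mul_pos hs0 hr
  have hpow {t : ℝ} (ht : 0 < t) (b : ℝ) :
      t ^ (finrank ℝ E - 1) * (t ^ b / t ^ ((finrank ℝ E : ℝ) + s * r)) =
        t ^ (b - s * r - 1) := by
    rw [← Real.rpow_natCast, ← Real.rpow_sub ht, ← Real.rpow_add ht, Nat.cast_sub hd]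
    congr 1
    push_cast
    ring
  rw [← Ioo_union_Ici_eq_Ioi (zero_lt_one (α := ℝ)), integrableOn_union,
    integrableOn_Ici_iff_integrableOn_Ioi]
  constructor
  · refine ((intervalIntegral.integrableOn_Ioo_rpow_iff (s := r - s * r - 1)
      zero_lt_one).2 (by nlinarith)).congr_fun (fun t ht ↦ ?_) measurableSet_Ioo
    simp only [smul_eq_mul, min_eq_right ht.2.le]
    exact (hpow ht.1 r).symm
  · refine (integrableOn_Ioi_rpow_of_lt (a := 0 - s * r - 1) (by linarith)
      zero_lt_one).congr_fun (fun t ht ↦ ?_) measurableSet_Ioi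
    simp only [smul_eq_mul, min_eq_left (le_of_lt (mem_Ioi.1 ht)), Real.one_rpow]
    rw [← hpow (zero_lt_one.trans (mem_Ioi.1 ht)) 0, Real.rpow_zero]

lemma gagliardoEnergy_lt_top [Nontrivial E] (μ : Measure E) [μ.IsAddHaarMeasure]
    {s r : ℝ} (hs0 : 0 < s) (hs1 : s < 1) (hr : 0 < r) {v : E → ℝ}
    (hv : ContDiff ℝ 1 v) (hsupp : HasCompactSupport v) :
    gagliardoEnergy μ s r v < ⊤ := by
  obtain ⟨L, hL⟩ := hv.lipschitzWith_of_hasCompactSupport hsupp one_ne_zero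
  obtain ⟨B, hB⟩ := hsupp.exists_bound_of_continuous hv.continuous
  have hB0 : 0 ≤ B := (norm_nonneg _).trans (hB 0)
  set C : ℝ := max L (2 * B) with hC
  have hC0 : 0 ≤ C := le_max_of_le_left L.2
  have hdiff (x y : E) : |v x - v y| ≤ C * min 1 ‖x - y‖ := by
    rw [mul_min_of_nonneg _ _ hC0]
    refine le_min ?_ ?_
    · have h₁ := hB x
      have h₂ := hB y
      rw [Real.norm_eq_abs] at h₁ h₂
      linarith [abs_sub (v x) (v y), le_max_right (L : ℝ) (2 * B)]
    · have := hL.dist_le_mul x y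
      rw [Real.dist_eq, dist_eq_norm] at this
      exact this.trans (by gcongr; exact le_max_left _ _)
  set k : E → ℝ := fun h ↦ (min 1 ‖h‖) ^ r / ‖h‖ ^ ((finrank ℝ E : ℝ) + s * r) with hk
  have hkint := integrable_gagliardo_kernel μ hs0 hs1 hr
  set G : E → ℝ≥0∞ := fun h ↦ ENNReal.ofReal (C ^ r * k h) with hG
  have hGint : ∫⁻ h, G h ∂μ < ⊤ := (hkint.const_mul (C ^ r)).lintegral_lt_top
  have hGm : Measurable G := by
    have : Measurable fun h : E ↦ ‖h‖ := measurable_norm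
    exact ((((measurable_const.min this).pow_const r).div
      (this.pow_const _)).const_mul _).ennreal_ofReal
  have hGsymm (x y : E) : G (x - y) = G (y - x) := by simp only [hG, hk, norm_sub_rev x y]
  set K : Set E := tsupport v
  have hKm : MeasurableSet K := (isClosed_tsupport v).measurableSet
  have hKfin : μ K < ⊤ := hsupp.isCompact.measure_lt_top
  set I : E → ℝ≥0∞ := K.indicator 1 with hI
  have hIm : Measurable I := measurable_one.indicator hKm
  have hprod : Measurable fun z : E × E ↦ I z.1 * G (z.2 - z.1) :=
    (hIm.comp measurable_fst).mul (hGm.comp (measurable_snd.sub measurable_fst))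
  have hdom (x y : E) :
      ENNReal.ofReal (|v x - v y| ^ r / ‖x - y‖ ^ ((finrank ℝ E : ℝ) + s * r)) ≤
        I x * G (y - x) + I y * G (x - y) := by
    have hle : ENNReal.ofReal (|v x - v y| ^ r / ‖x - y‖ ^ ((finrank ℝ E : ℝ) + s * r)) ≤
        G (x - y) := by
      apply ENNReal.ofReal_le_ofReal
      rw [hk, ← mul_div_assoc, ← Real.mul_rpow hC0 (by positivity)]
      gcongr
      exact hdiff x y
    by_cases hx : x ∈ K
    · refine hle.trans (le_add_right ?_)
      simp [hI, hx, hGsymm x y]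
    by_cases hy : y ∈ K
    · refine hle.trans (le_add_left ?_)
      simp [hI, hy]
    · simp [image_eq_zero_of_notMem_tsupport hx, image_eq_zero_of_notMem_tsupport hy,
        Real.zero_rpow hr.ne']
  have hone : ∫⁻ x, ∫⁻ y, I x * G (y - x) ∂μ ∂μ = μ K * ∫⁻ h, G h ∂μ := by
    have (x : E) : ∫⁻ y, I x * G (y - x) ∂μ = I x * ∫⁻ h, G h ∂μ := by
      have hGx : Measurable fun y ↦ G (y - x) := hGm.comp (measurable_id.sub_const x)
      rw [lintegral_const_mul _ hGx, lintegral_sub_right_eq_self G x]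
    simp_rw [this]
    rw [lintegral_mul_const _ hIm, lintegral_indicator_one hKm]
  have htwo : ∫⁻ x, ∫⁻ y, I y * G (x - y) ∂μ ∂μ = μ K * ∫⁻ h, G h ∂μ := by
    rw [← hone]
    exact lintegral_lintegral_swap (hprod.comp measurable_swap).aemeasurable
  calc gagliardoEnergy μ s r v
      ≤ ∫⁻ x, ∫⁻ y, (I x * G (y - x) + I y * G (x - y)) ∂μ ∂μ :=
        lintegral_mono fun x ↦ lintegral_mono fun y ↦ hdom x y
    _ = μ K * ∫⁻ h, G h ∂μ + μ K * ∫⁻ h, G h ∂μ := by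
        nth_rewrite 1 [← hone]
        rw [← htwo, ← lintegral_add_left hprod.lintegral_prod_right']
        refine lintegral_congr fun x ↦ lintegral_add_left ?_ _
        exact hprod.comp (measurable_prodMk_left (x := x))
    _ < ⊤ := ENNReal.add_lt_top.2
        ⟨ENNReal.mul_lt_top hKfin hGint, ENNReal.mul_lt_top hKfin hGint⟩

lemma iSup_setLIntegral_annulus_rpow_neg_finrank [Nontrivial E] (μ : Measure E)
    [μ.IsAddHaarMeasure] :
    ⨆ m : ℕ, ∫⁻ x in {x : E | 2 / ((m : ℝ) + 2) ≤ ‖x‖ ∧ ‖x‖ < 1},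
      ENNReal.ofReal (‖x‖ ^ (-(finrank ℝ E : ℝ))) ∂μ = ⊤ := by
  have hmono : Monotone fun m : ℕ ↦ {x : E | 2 / ((m : ℝ) + 2) ≤ ‖x‖ ∧ ‖x‖ < 1} := by
    intro m n hmn x hx
    refine ⟨le_trans ?_ hx.1, hx.2⟩
    gcongr
  rw [← setLIntegral_iUnion_of_directed _ hmono.directed_le]
  have hunion : (⋃ m : ℕ, {x : E | 2 / ((m : ℝ) + 2) ≤ ‖x‖ ∧ ‖x‖ < 1}) =
      Metric.ball (0 : E) 1 \ {0} := by
    ext x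
    simp only [mem_iUnion, mem_ofPred_eq, Set.mem_sdiff, mem_ball_zero_iff, mem_singleton_iff]
    constructor
    · rintro ⟨m, h, h'⟩
      exact ⟨h', norm_pos_iff.1 (lt_of_lt_of_le (by positivity) h)⟩
    · rintro ⟨h, h'⟩
      obtain ⟨m, hm⟩ := exists_nat_gt (2 / ‖x‖)
      refine ⟨m, ?_, h⟩
      have hx := norm_pos_iff.2 h'
      rw [div_lt_iff₀ hx] at hm
      rw [div_le_iff₀ (by positivity)]
      nlinarith
  rw [hunion, setLIntegral_congr (sdiff_null_ae_eq_self (measure_singleton 0))]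
  by_contra hfin
  have hball : IntegrableOn (fun x : E ↦ ‖x‖ ^ (-(finrank ℝ E : ℝ))) (Metric.ball 0 1) μ := by
    have hm : Measurable fun x : E ↦ ‖x‖ ^ (-(finrank ℝ E : ℝ)) :=
      measurable_norm.pow_const _
    exact (lintegral_ofReal_ne_top_iff_integrable hm.aestronglyMeasurable
      (ae_of_all _ fun x ↦ by positivity)).1 hfin
  have := (integrableOn_fun_norm_addHaar μ
    (f := fun t : ℝ ↦ t ^ (-(finrank ℝ E : ℝ)))).1 hball
  have hd : 1 ≤ finrank ℝ E := finrank_pos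
  have h' : IntegrableOn (fun t : ℝ ↦ t ^ (-1 : ℝ)) (Ioo 0 1) := by
    refine this.congr_fun (fun t ht ↦ ?_) measurableSet_Ioo
    simp only [smul_eq_mul]
    rw [← Real.rpow_natCast, ← Real.rpow_add ht.1, Nat.cast_sub hd]
    congr 1
    push_cast
    ring
  exact lt_irrefl _ ((intervalIntegral.integrableOn_Ioo_rpow_iff zero_lt_one).1 h')

end GagliardoEnergy

/-- Failure of the (unweighted) fractional Orlicz–Hardy inequality for
`S(t) = t^p + t^q` at the critical exponent `γ = s = N/q`: there is a sequence
of admissible test functions supported away from the origin for which the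
right-hand side stays bounded while the left-hand side blows up like `log n`. -/
theorem fractional_orlicz_hardy_fails_sum_power
    (N : ℕ) (hN : 1 ≤ N) (p q s : ℝ) (hp : 1 < p) (hpq : p < q)
    (hs : s ∈ Ioo (0:ℝ) 1) (hNq : (N : ℝ) = s * q)
    (S : ℝ → ℝ) (hS : ∀ t, S t = t ^ p + t ^ q) :
    ∃ u : ℕ → EuclideanSpace ℝ (Fin N) → ℝ,
      (∀ n, ContDiff ℝ 1 (u n) ∧ HasCompactSupport (u n) ∧
        (0 : EuclideanSpace ℝ (Fin N)) ∉ tsupport (u n) ∧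
        ∀ x, u n x ∈ Icc (0:ℝ) 1) ∧
      (∃ M : ℝ≥0∞, M ≠ ⊤ ∧ ∀ n,
        (∫⁻ x, ∫⁻ y, ENNReal.ofReal
            (S (|u n x - u n y| / ‖x - y‖ ^ s) / ‖x - y‖ ^ (N:ℝ))) ≤ M) ∧
      ∀ n : ℕ, ENNReal.ofReal (Real.log (n / 2)) ≤
        ∫⁻ x, ENNReal.ofReal (S (u n x / ‖x‖ ^ s)) := by
  have hN0 : (0 : ℝ) < N := by exact_mod_cast hN
  have hp0 : 0 < p := by linarith
  have hq0 : 0 < q := by linarith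
  obtain ⟨hs0, hs1⟩ := hs
  have : Nonempty (Fin N) := ⟨⟨0, hN⟩⟩
  have hfin : finrank ℝ (EuclideanSpace ℝ (Fin N)) = N := finrank_euclideanSpace_fin
  let φ : ContDiffBump (0 : EuclideanSpace ℝ (Fin N)) := ⟨1, 2, zero_lt_one, one_lt_two⟩
  have hφ : ContDiff ℝ 1 φ := φ.contDiff
  have hex (n : ℕ) : ∃ m : ℕ, ENNReal.ofReal (Real.log (n / 2)) ≤
      ∫⁻ x in {x : EuclideanSpace ℝ (Fin N) | 2 / ((m : ℝ) + 2) ≤ ‖x‖ ∧ ‖x‖ < 1},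
        ENNReal.ofReal (‖x‖ ^ (-(N : ℝ))) := by
    have h := iSup_setLIntegral_annulus_rpow_neg_finrank
      (volume : Measure (EuclideanSpace ℝ (Fin N)))
    rw [hfin] at h
    obtain ⟨m, hm⟩ := lt_iSup_iff.1
      (h ▸ ENNReal.ofReal_lt_top : ENNReal.ofReal (Real.log (n / 2)) < _)
    exact ⟨m, hm.le⟩
  choose m hm using hex
  set c : ℕ → ℝ := fun n ↦ (m n : ℝ) + 2 with hc
  have hc2 (n : ℕ) : 2 ≤ c n := by simp [hc]
  have hc0 (n : ℕ) : 0 < c n := by linarith [hc2 n]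
  have hnorm (n : ℕ) (x : EuclideanSpace ℝ (Fin N)) : ‖c n • x‖ = c n * ‖x‖ := by
    rw [norm_smul, Real.norm_eq_abs, abs_of_pos (hc0 n)]
  have hone {x : EuclideanSpace ℝ (Fin N)} (hx : ‖x‖ ≤ 1) : φ x = 1 :=
    φ.one_of_mem_closedBall (mem_closedBall_zero_iff.2 hx)
  have hzero {x : EuclideanSpace ℝ (Fin N)} (hx : 2 ≤ ‖x‖) : φ x = 0 :=
    φ.zero_of_le_dist (by rwa [dist_zero_right])
  refine ⟨fun n x ↦ φ x - φ (c n • x), fun n ↦ ⟨?_, ?_, ?_, fun x ↦ ?_⟩, ?_, fun n ↦ ?_⟩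
  · exact hφ.sub (hφ.comp (contDiff_const_smul _))
  · exact φ.hasCompactSupport.sub (φ.hasCompactSupport.comp_smul (hc0 n).ne')
  · rw [notMem_tsupport_iff_eventuallyEq]
    filter_upwards [Metric.ball_mem_nhds _ (inv_pos.2 (hc0 n))] with x hx
    rw [mem_ball_zero_iff, ← one_div, lt_div_iff₀ (hc0 n)] at hx
    have hx' : ‖x‖ ≤ 1 := by nlinarith [hc2 n, norm_nonneg x]
    simp [hone hx', hone (show ‖c n • x‖ ≤ 1 by rw [hnorm]; linarith)]
  · rcases le_or_gt ‖x‖ 1 with hx | hx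
    · simp only [hone hx]
      exact ⟨by linarith [φ.le_one (x := c n • x)], by linarith [φ.nonneg (x := c n • x)]⟩
    · have : φ (c n • x) = 0 := hzero (by rw [hnorm]; nlinarith [hc2 n])
      simp only [this, sub_zero]
      exact ⟨φ.nonneg, φ.le_one⟩
  · have henergy {r : ℝ} (hr : 0 < r) (hrq : r ≤ q) (n : ℕ) :
        gagliardoEnergy volume s r (fun x ↦ φ x - φ (c n • x)) ≤
          ENNReal.ofReal (2 ^ r) *
            (gagliardoEnergy volume s r φ + gagliardoEnergy volume s r φ) := by
      refine (gagliardoEnergy_sub_le volume s hr.le hφ.continuous.measurable _).trans ?_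
      gcongr
      refine gagliardoEnergy_comp_smul_le volume (by linarith [hc2 n]) ?_ φ
      rw [hfin, hNq]
      gcongr
    have htop {r : ℝ} (hr : 0 < r) : ENNReal.ofReal (2 ^ r) *
        (gagliardoEnergy volume s r φ + gagliardoEnergy volume s r φ) ≠ ⊤ := by
      have := (gagliardoEnergy_lt_top volume hs0 hs1 hr hφ φ.hasCompactSupport).ne
      exact ENNReal.mul_ne_top ENNReal.ofReal_ne_top (ENNReal.add_ne_top.2 ⟨this, this⟩)
    refine ⟨_, ENNReal.add_ne_top.2 ⟨htop hp0, htop hq0⟩, fun n ↦ ?_⟩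
    refine le_trans (le_of_eq ?_) (add_le_add (henergy hp0 hpq.le n) (henergy hq0 le_rfl n))
    have hmeas : Measurable fun x ↦ φ x - φ (c n • x) :=
      (hφ.continuous.sub (hφ.continuous.comp (continuous_const_smul (c n)))).measurable
    have hmp := measurable_gagliardo_integrand hmeas p ((N : ℝ) + s * p)
    unfold gagliardoEnergy
    rw [hfin, ← lintegral_add_left hmp.lintegral_prod_right']
    refine lintegral_congr fun x ↦ ?_
    have hx := hmp.comp (measurable_prodMk_left (x := x))
    simp only [Function.comp_def] at hx
    rw [← lintegral_add_left hx]
    refine lintegral_congr fun y ↦ ?_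
    have hterm {r : ℝ} (hr : 0 < r) (d : ℝ) (hd : 0 ≤ d) :
        (d / ‖x - y‖ ^ s) ^ r / ‖x - y‖ ^ (N : ℝ) = d ^ r / ‖x - y‖ ^ ((N : ℝ) + s * r) := by
      rw [Real.div_rpow hd (by positivity), ← Real.rpow_mul (norm_nonneg _), div_div,
        ← Real.rpow_add_of_nonneg (norm_nonneg _) (by positivity) hN0.le, add_comm]
    rw [← ENNReal.ofReal_add (by positivity) (by positivity), hS, add_div,
      hterm hp0 _ (abs_nonneg _), hterm hq0 _ (abs_nonneg _)]
  · have hmeasurable : MeasurableSet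
        {x : EuclideanSpace ℝ (Fin N) | 2 / ((m n : ℝ) + 2) ≤ ‖x‖ ∧ ‖x‖ < 1} :=
      (measurableSet_le measurable_const measurable_norm).inter
        (measurableSet_lt measurable_norm measurable_const)
    refine (hm n).trans ((setLIntegral_mono' hmeasurable fun x hx ↦ ?_).trans
      (setLIntegral_le_lintegral _ _))
    have hx1 : φ x = 1 := hone hx.2.le
    have hx2 : φ (c n • x) = 0 := by
      refine hzero ?_
      rw [hnorm, mul_comm]
      exact (div_le_iff₀ (hc0 n)).1 hx.1
    apply ENNReal.ofReal_le_ofReal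
    simp only [hx1, hx2, sub_zero, hS]
    have hq : (1 / ‖x‖ ^ s) ^ q = ‖x‖ ^ (-(N : ℝ)) := by
      rw [one_div, ← Real.rpow_neg (norm_nonneg _), ← Real.rpow_mul (norm_nonneg _), hNq,
        neg_mul]
    rw [hq]
    exact le_add_of_nonneg_left (by positivity)
end
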